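/- arXiv:1910.11199 — 3 statements merged into one kernel-verified Lean document; each statement's English description precedes it below -/
import Mathlib

section
/- Let f be Lipschitz continuous on an open neighborhood of the closed ball B̄_ε(x), where x ∈ X and ε > 0. Then there is a unique element ã ∈ ∂^ε f(x) of minimal norm, i.e. ‖ã‖ = min_{a ∈ ∂^ε f(x)} ‖a‖. If moreover 0 ∉ ∂^ε f(x), then h̃ := −ã/‖ã‖ satisfies f⁰_ε(x;h̃) = min_{‖h‖≤1} f⁰_ε(x;h) = −‖ã‖ < 0, and h̃ is the unique vector h with ‖h‖ = 1 and f⁰_ε(x;h) = min_{‖h'‖≤1} f⁰_ε(x;h') (the unique optimal descent direction of f on B̄_ε(x)). -/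
open Filter Metric Set Topology MeasureTheory
open scoped RealInnerProductSpace NNReal

variable {X : Type*} [NormedAddCommGroup X] [InnerProductSpace ℝ X] [CompleteSpace X]

/-- Clarke's generalized directional derivative. -/
noncomputable def clarkeDeriv (f : X → ℝ) (x h : X) : ℝ :=
  Filter.limsup (fun p : X × ℝ => (f (p.1 + p.2 • h) - f p.1) / p.2)
    ((𝓝 x) ×ˢ (𝓝[>] (0:ℝ)))

/-- Clarke's generalized gradient. -/
noncomputable def clarkeGrad (f : X → ℝ) (x : X) : Set X :=
  {a | ∀ h : X, ⟪a, h⟫ ≤ clarkeDeriv f x h}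

/-- The gradient of `f` on the closed ball of radius `ε` about `x`. -/
noncomputable def epsGrad (f : X → ℝ) (ε : ℝ) (x : X) : Set X :=
  closure (convexHull ℝ (⋃ y ∈ Metric.closedBall x ε, clarkeGrad f y))

/-- The directional derivative of `f` on the closed ball of radius `ε` about `x`. -/
noncomputable def epsDeriv (f : X → ℝ) (ε : ℝ) (x h : X) : ℝ :=
  sSup ((fun y => clarkeDeriv f y h) '' Metric.closedBall x ε)

omit [CompleteSpace X] in
lemma tendsto_add_smul_nhds (x h : X) :
    Tendsto (fun p : X × ℝ => p.1 + p.2 • h) ((𝓝 x) ×ˢ (𝓝[>] (0:ℝ))) (𝓝 x) := by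
  have h0 : Tendsto (fun p : X × ℝ => p.1 + p.2 • h) (𝓝 (x, (0:ℝ))) (𝓝 (x + (0:ℝ) • h)) :=
    Continuous.tendsto (by fun_prop) (x, (0:ℝ))
  rw [zero_smul, add_zero, nhds_prod_eq] at h0
  exact h0.mono_left (Filter.prod_mono le_rfl nhdsWithin_le_nhds)

omit [CompleteSpace X] in
/-- The difference quotient of a function which is Lipschitz near `x` is eventually bounded. -/
lemma eventually_abs_diffQuot_le {f : X → ℝ} {x : X} {L : ℝ≥0} {U : Set X}
    (hU : U ∈ 𝓝 x) (hf : LipschitzOnWith L f U) (h : X) :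
    ∀ᶠ p : X × ℝ in (𝓝 x) ×ˢ (𝓝[>] (0:ℝ)), |(f (p.1 + p.2 • h) - f p.1) / p.2| ≤ L * ‖h‖ := by
  have hpos : ∀ᶠ p : X × ℝ in (𝓝 x) ×ˢ (𝓝[>] (0:ℝ)), 0 < p.2 :=
    tendsto_snd.eventually self_mem_nhdsWithin
  filter_upwards [(tendsto_add_smul_nhds x h).eventually hU, tendsto_fst.eventually hU, hpos]
    with p h1 h2 h3
  have := hf.dist_le_mul _ h1 _ h2
  rw [Real.dist_eq, dist_eq_norm, add_sub_cancel_left, norm_smul, Real.norm_eq_abs,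
    abs_of_pos h3] at this
  rw [abs_div, abs_of_pos h3, div_le_iff₀ h3]
  linarith

section

variable {f : X → ℝ} {x : X} {L : ℝ≥0} {U : Set X}

omit [CompleteSpace X] in
lemma isBoundedUnder_diffQuot (hU : U ∈ 𝓝 x) (hf : LipschitzOnWith L f U) (h : X) :
    IsBoundedUnder (· ≤ ·) ((𝓝 x) ×ˢ (𝓝[>] (0:ℝ)))
      (fun p : X × ℝ => (f (p.1 + p.2 • h) - f p.1) / p.2) :=
  isBoundedUnder_of_eventually_le
    ((eventually_abs_diffQuot_le hU hf h).mono fun _ hp => (abs_le.1 hp).2)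

omit [CompleteSpace X] in
lemma isCoboundedUnder_diffQuot (hU : U ∈ 𝓝 x) (hf : LipschitzOnWith L f U) (h : X) :
    IsCoboundedUnder (· ≤ ·) ((𝓝 x) ×ˢ (𝓝[>] (0:ℝ)))
      (fun p : X × ℝ => (f (p.1 + p.2 • h) - f p.1) / p.2) :=
  (isBoundedUnder_of_eventually_ge
    ((eventually_abs_diffQuot_le hU hf h).mono fun _ hp => (abs_le.1 hp).1)).isCoboundedUnder_le

omit [CompleteSpace X] in
lemma clarkeDeriv_le_of_eventually (hU : U ∈ 𝓝 x) (hf : LipschitzOnWith L f U) {h : X} {c : ℝ}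
    (hc : ∀ᶠ p : X × ℝ in (𝓝 x) ×ˢ (𝓝[>] (0:ℝ)), (f (p.1 + p.2 • h) - f p.1) / p.2 ≤ c) :
    clarkeDeriv f x h ≤ c :=
  limsup_le_of_le (isCoboundedUnder_diffQuot hU hf h) hc

omit [CompleteSpace X] in
lemma eventually_lt_of_clarkeDeriv_lt (hU : U ∈ 𝓝 x) (hf : LipschitzOnWith L f U) {h : X} {c : ℝ}
    (hc : clarkeDeriv f x h < c) :
    ∀ᶠ p : X × ℝ in (𝓝 x) ×ˢ (𝓝[>] (0:ℝ)), (f (p.1 + p.2 • h) - f p.1) / p.2 < c :=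
  eventually_lt_of_limsup_lt hc (isBoundedUnder_diffQuot hU hf h)

omit [CompleteSpace X] in
lemma clarkeDeriv_le_mul_norm (hU : U ∈ 𝓝 x) (hf : LipschitzOnWith L f U) (h : X) :
    clarkeDeriv f x h ≤ L * ‖h‖ :=
  clarkeDeriv_le_of_eventually hU hf
    ((eventually_abs_diffQuot_le hU hf h).mono fun _ hp => (abs_le.1 hp).2)

omit [CompleteSpace X] in
@[simp]
lemma clarkeDeriv_zero (f : X → ℝ) (x : X) : clarkeDeriv f x 0 = 0 := by
  simp [clarkeDeriv]

omit [CompleteSpace X] in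
lemma clarkeDeriv_add_le (hU : U ∈ 𝓝 x) (hf : LipschitzOnWith L f U) (h k : X) :
    clarkeDeriv f x (h + k) ≤ clarkeDeriv f x h + clarkeDeriv f x k := by
  refine le_of_forall_pos_le_add fun δ hδ => clarkeDeriv_le_of_eventually hU hf ?_
  have e1 := eventually_lt_of_clarkeDeriv_lt hU hf
    (show clarkeDeriv f x h < clarkeDeriv f x h + δ / 2 by linarith)
  have e2 := eventually_lt_of_clarkeDeriv_lt hU hf
    (show clarkeDeriv f x k < clarkeDeriv f x k + δ / 2 by linarith)
  have hshift : Tendsto (fun p : X × ℝ => (p.1 + p.2 • h, p.2)) ((𝓝 x) ×ˢ (𝓝[>] (0:ℝ)))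
      ((𝓝 x) ×ˢ (𝓝[>] (0:ℝ))) :=
    (tendsto_add_smul_nhds x h).prodMk tendsto_snd
  filter_upwards [e1, hshift.eventually e2] with p h1 h2
  have hsplit : (f (p.1 + p.2 • (h + k)) - f p.1) / p.2 =
      (f (p.1 + p.2 • h) - f p.1) / p.2 +
        (f (p.1 + p.2 • h + p.2 • k) - f (p.1 + p.2 • h)) / p.2 := by
    rw [smul_add, ← add_assoc]; ring
  rw [hsplit]
  linarith

omit [CompleteSpace X] in
lemma clarkeDeriv_smul_le (hU : U ∈ 𝓝 x) (hf : LipschitzOnWith L f U) {c : ℝ} (hc : 0 < c)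
    (h : X) : clarkeDeriv f x (c • h) ≤ c * clarkeDeriv f x h := by
  refine le_of_forall_pos_le_add fun δ hδ => clarkeDeriv_le_of_eventually hU hf ?_
  have e1 := eventually_lt_of_clarkeDeriv_lt hU hf
    (show clarkeDeriv f x h < clarkeDeriv f x h + δ / c by linarith [div_pos hδ hc])
  have hscale : Tendsto (fun t : ℝ => t * c) (𝓝[>] (0:ℝ)) (𝓝[>] (0:ℝ)) := by
    refine tendsto_nhdsWithin_iff.2 ⟨?_, ?_⟩
    · have : Tendsto (fun t : ℝ => t * c) (𝓝 0) (𝓝 (0 * c)) :=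
        Continuous.tendsto (by fun_prop) 0
      rw [zero_mul] at this
      exact this.mono_left nhdsWithin_le_nhds
    · filter_upwards [self_mem_nhdsWithin] with t ht
      exact mul_pos ht hc
  have hmap := (tendsto_id (α := X) (x := 𝓝 x)).prodMap hscale
  filter_upwards [hmap.eventually e1] with p h1
  simp only [Prod.map_fst, Prod.map_snd, id] at h1
  have hrw : (f (p.1 + p.2 • c • h) - f p.1) / p.2 =
      c * ((f (p.1 + (p.2 * c) • h) - f p.1) / (p.2 * c)) := by
    rw [smul_smul]; field_simp
  rw [hrw]
  calc c * ((f (p.1 + (p.2 * c) • h) - f p.1) / (p.2 * c))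
      ≤ c * (clarkeDeriv f x h + δ / c) := mul_le_mul_of_nonneg_left h1.le hc.le
    _ = c * clarkeDeriv f x h + δ := by field_simp

omit [CompleteSpace X] in
lemma clarkeDeriv_smul (hU : U ∈ 𝓝 x) (hf : LipschitzOnWith L f U) {c : ℝ} (hc : 0 < c)
    (h : X) : clarkeDeriv f x (c • h) = c * clarkeDeriv f x h := by
  refine (clarkeDeriv_smul_le hU hf hc h).antisymm ?_
  have := clarkeDeriv_smul_le hU hf (inv_pos.2 hc) (c • h)
  rw [inv_smul_smul₀ hc.ne'] at this
  rwa [← le_inv_mul_iff₀ hc]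

omit [CompleteSpace X] in
lemma mul_clarkeDeriv_le (hU : U ∈ 𝓝 x) (hf : LipschitzOnWith L f U) (c : ℝ) (h : X) :
    c * clarkeDeriv f x h ≤ clarkeDeriv f x (c • h) := by
  rcases lt_trichotomy c 0 with hc | rfl | hc
  · have h1 := clarkeDeriv_smul hU hf (neg_pos.2 hc) h
    have h2 := clarkeDeriv_add_le hU hf (c • h) (-c • h)
    rw [← add_smul, add_neg_cancel, zero_smul, clarkeDeriv_zero] at h2
    linarith
  · simp
  · exact (clarkeDeriv_smul hU hf hc h).ge

/-- The Clarke derivative is the support function of the Clarke gradient, with the supremum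
attained. -/
lemma exists_mem_clarkeGrad_inner_eq (hU : U ∈ 𝓝 x) (hf : LipschitzOnWith L f U) (h : X) :
    ∃ a ∈ clarkeGrad f x, ⟪a, h⟫ = clarkeDeriv f x h := by
  have H : ∀ c : ℝ, c • h = 0 → c • clarkeDeriv f x h = 0 := by
    intro c hc
    rcases smul_eq_zero.1 hc with rfl | rfl <;> simp
  obtain ⟨g, hg, hgN⟩ := exists_extension_of_le_sublinear
    (LinearPMap.mkSpanSingleton' (σ := RingHom.id ℝ) h (clarkeDeriv f x h) H) (clarkeDeriv f x)
    (fun c hc k => clarkeDeriv_smul hU hf hc k) (clarkeDeriv_add_le hU hf) (by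
      rintro ⟨k, hk⟩
      obtain ⟨c, rfl⟩ := Submodule.mem_span_singleton.1 hk
      rw [LinearPMap.mkSpanSingleton'_apply]
      exact mul_clarkeDeriv_le hU hf c h)
  have hb : ∀ k, ‖g k‖ ≤ L * ‖k‖ := by
    intro k
    have h1 := (hgN k).trans (clarkeDeriv_le_mul_norm hU hf k)
    have h2 := (hgN (-k)).trans (clarkeDeriv_le_mul_norm hU hf (-k))
    rw [map_neg, norm_neg] at h2
    exact abs_le.2 ⟨by linarith, h1⟩
  refine ⟨(InnerProductSpace.toDual ℝ X).symm (g.mkContinuous L hb), fun k => ?_, ?_⟩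
  · rw [InnerProductSpace.toDual_symm_apply]
    exact hgN k
  · rw [InnerProductSpace.toDual_symm_apply]
    have hmem : h ∈ (LinearPMap.mkSpanSingleton' (σ := RingHom.id ℝ) h (clarkeDeriv f x h) H).domain :=
      Submodule.mem_span_singleton_self h
    have := hg ⟨h, hmem⟩
    rw [LinearPMap.mkSpanSingleton'_apply_self] at this
    exact this

end

section

variable {f : X → ℝ} {x : X} {ε : ℝ} {L : ℝ≥0} {U : Set X}

omit [CompleteSpace X] in
lemma clarkeGrad_subset_epsGrad {y : X} (hy : y ∈ Metric.closedBall x ε) :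
    clarkeGrad f y ⊆ epsGrad f ε x :=
  (subset_biUnion_of_mem (u := fun y => clarkeGrad f y) hy).trans
    ((subset_convexHull ℝ _).trans subset_closure)

omit [CompleteSpace X] in
lemma inner_le_epsDeriv (hU : IsOpen U) (hBU : Metric.closedBall x ε ⊆ U)
    (hf : LipschitzOnWith L f U) {b : X} (hb : b ∈ epsGrad f ε x) (h : X) :
    ⟪b, h⟫ ≤ epsDeriv f ε x h := by
  have hbdd : BddAbove ((fun y => clarkeDeriv f y h) '' Metric.closedBall x ε) := by
    refine ⟨L * ‖h‖, ?_⟩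
    rintro _ ⟨y, hy, rfl⟩
    exact clarkeDeriv_le_mul_norm (hU.mem_nhds (hBU hy)) hf h
  have hclosed : IsClosed {b : X | ⟪b, h⟫ ≤ epsDeriv f ε x h} :=
    isClosed_le (by fun_prop) continuous_const
  have hconv : Convex ℝ {b : X | ⟪b, h⟫ ≤ epsDeriv f ε x h} :=
    convex_halfSpace_le
      ⟨fun u v => inner_add_left u v h, fun c u => by simp [real_inner_smul_left]⟩ _
  refine closure_minimal (convexHull_min (iUnion₂_subset fun y hy a ha => ?_) hconv) hclosed hb
  exact (ha h).trans (le_csSup hbdd ⟨y, hy, rfl⟩)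

lemma epsDeriv_le (hε : 0 < ε) (hU : IsOpen U) (hBU : Metric.closedBall x ε ⊆ U)
    (hf : LipschitzOnWith L f U) {h : X} {c : ℝ} (hc : ∀ b ∈ epsGrad f ε x, ⟪b, h⟫ ≤ c) :
    epsDeriv f ε x h ≤ c := by
  refine csSup_le ((nonempty_closedBall.2 hε.le).image _) ?_
  rintro _ ⟨y, hy, rfl⟩
  obtain ⟨a, ha, hah⟩ := exists_mem_clarkeGrad_inner_eq (hU.mem_nhds (hBU hy)) hf h
  exact hah.ge.trans (hc a (clarkeGrad_subset_epsGrad hy ha))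

lemma epsGrad_nonempty (hε : 0 < ε) (hU : IsOpen U) (hBU : Metric.closedBall x ε ⊆ U)
    (hf : LipschitzOnWith L f U) : (epsGrad f ε x).Nonempty := by
  have hx : x ∈ Metric.closedBall x ε := mem_closedBall_self hε.le
  obtain ⟨a, ha, -⟩ := exists_mem_clarkeGrad_inner_eq (hU.mem_nhds (hBU hx)) hf 0
  exact ⟨a, clarkeGrad_subset_epsGrad hx ha⟩

omit [CompleteSpace X] in
lemma convex_epsGrad (f : X → ℝ) (ε : ℝ) (x : X) : Convex ℝ (epsGrad f ε x) :=
  (convex_convexHull ℝ _).closure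

end

omit [CompleteSpace X] in
/-- An element of minimal norm of a convex set satisfies the variational inequality. -/
lemma Convex.sq_norm_le_inner_of_minNorm {K : Set X} (hK : Convex ℝ K) {a : X} (ha : a ∈ K)
    (hmin : ∀ b ∈ K, ‖a‖ ≤ ‖b‖) {b : X} (hb : b ∈ K) : ‖a‖ ^ 2 ≤ ⟪a, b⟫ := by
  have : Nonempty K := ⟨⟨a, ha⟩⟩
  have hinf : ‖(0 : X) - a‖ = ⨅ w : K, ‖(0 : X) - w‖ := by
    simp only [zero_sub, norm_neg]
    refine le_antisymm (le_ciInf fun w => hmin w w.2) ?_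
    exact ciInf_le (f := fun w : K => ‖(w : X)‖)
      ⟨0, by rintro _ ⟨w, rfl⟩; exact norm_nonneg _⟩ ⟨a, ha⟩
  have h := (norm_eq_iInf_iff_real_inner_le_zero hK ha).1 hinf b hb
  rw [zero_sub, inner_neg_left, inner_sub_right, real_inner_self_eq_norm_sq] at h
  linarith

/-- A nonempty closed convex set in a Hilbert space has a unique element of minimal norm. -/
lemma Convex.existsUnique_minNorm {K : Set X} (hK : Convex ℝ K) (hcl : IsClosed K)
    (hne : K.Nonempty) : ∃! a : X, a ∈ K ∧ ∀ b ∈ K, ‖a‖ ≤ ‖b‖ := by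
  obtain ⟨a, ha, hinf⟩ := exists_norm_eq_iInf_of_complete_convex hne hcl.isComplete hK 0
  have hmin : ∀ b ∈ K, ‖a‖ ≤ ‖b‖ := by
    intro b hb
    simp only [zero_sub, norm_neg] at hinf
    rw [hinf]
    exact ciInf_le (f := fun w : K => ‖(w : X)‖)
      ⟨0, by rintro _ ⟨w, rfl⟩; exact norm_nonneg _⟩ ⟨b, hb⟩
  refine ⟨a, ⟨ha, hmin⟩, ?_⟩
  rintro b ⟨hb, hbmin⟩
  have h1 := hK.sq_norm_le_inner_of_minNorm ha hmin hb
  have h2 := hK.sq_norm_le_inner_of_minNorm hb hbmin ha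
  have h3 := norm_sub_sq_real b a
  rw [real_inner_comm] at h1
  have h4 : ‖b - a‖ ^ 2 ≤ 0 := by linarith
  exact sub_eq_zero.1 (norm_eq_zero.1 (pow_eq_zero_iff two_ne_zero |>.1 (h4.antisymm (sq_nonneg _))))

/-- Proposition 2.3: existence and uniqueness of the norm-minimal element of `∂^ε f(x)`,
and, when `0 ∉ ∂^ε f(x)`, of the optimal descent direction `h̃ = -ã/‖ã‖`. -/
theorem exists_unique_minNorm_and_optimal_descent
    (f : X → ℝ) (x : X) (ε : ℝ) (hε : 0 < ε) (L : ℝ≥0) (U : Set X)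
    (hU : IsOpen U) (hBU : Metric.closedBall x ε ⊆ U)
    (hf : LipschitzOnWith L f U) :
    (∃! a : X, a ∈ epsGrad f ε x ∧ ∀ b ∈ epsGrad f ε x, ‖a‖ ≤ ‖b‖) ∧
    ((0 : X) ∉ epsGrad f ε x →
      ∀ a : X, (a ∈ epsGrad f ε x ∧ ∀ b ∈ epsGrad f ε x, ‖a‖ ≤ ‖b‖) →
        (‖-(‖a‖⁻¹ • a)‖ = 1) ∧
        epsDeriv f ε x (-(‖a‖⁻¹ • a)) = -‖a‖ ∧
        (∀ h : X, ‖h‖ ≤ 1 → -‖a‖ ≤ epsDeriv f ε x h) ∧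
        -‖a‖ < 0 ∧
        (∀ h : X, ‖h‖ = 1 → (∀ h' : X, ‖h'‖ ≤ 1 → epsDeriv f ε x h ≤ epsDeriv f ε x h') →
          h = -(‖a‖⁻¹ • a))) := by
  refine ⟨(convex_epsGrad f ε x).existsUnique_minNorm isClosed_closure
    (epsGrad_nonempty hε hU hBU hf), ?_⟩
  rintro h0 a ⟨ha, hmin⟩
  have hane : a ≠ 0 := fun h => h0 (h ▸ ha)
  have hpos : 0 < ‖a‖ := norm_pos_iff.2 hane
  have hnorm : ‖-(‖a‖⁻¹ • a)‖ = 1 := by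
    rw [norm_neg, norm_smul, norm_inv, norm_norm, inv_mul_cancel₀ hpos.ne']
  have hlower : ∀ h : X, ‖h‖ ≤ 1 → -‖a‖ ≤ epsDeriv f ε x h := by
    intro h hh
    have h1 := inner_le_epsDeriv hU hBU hf ha h
    have h2 := (abs_le.1 (abs_real_inner_le_norm a h)).1
    have h3 : ‖a‖ * ‖h‖ ≤ ‖a‖ := mul_le_of_le_one_right hpos.le hh
    linarith
  have hval : epsDeriv f ε x (-(‖a‖⁻¹ • a)) = -‖a‖ := by
    refine le_antisymm (epsDeriv_le hε hU hBU hf fun b hb => ?_) (hlower _ hnorm.le)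
    have h1 := (convex_epsGrad f ε x).sq_norm_le_inner_of_minNorm ha hmin hb
    rw [inner_neg_right, real_inner_smul_right, real_inner_comm, neg_le_neg_iff,
      le_inv_mul_iff₀ hpos]
    linarith
  refine ⟨hnorm, hval, hlower, neg_lt_zero.2 hpos, fun h hh hopt => ?_⟩
  have h1 : ⟪a, h⟫ ≤ -‖a‖ :=
    (inner_le_epsDeriv hU hBU hf ha h).trans ((hopt _ hnorm.le).trans hval.le)
  have h2 : ⟪h, -(‖a‖⁻¹ • a)⟫ = 1 := by
    refine le_antisymm ?_ ?_
    · simpa [hh, hnorm] using real_inner_le_norm h (-(‖a‖⁻¹ • a))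
    · rw [inner_neg_right, real_inner_smul_right, real_inner_comm, ← mul_neg,
        le_inv_mul_iff₀ hpos]
      linarith
  exact (inner_eq_one_iff_of_norm_eq_one hh hnorm).1 h2
end

section
/- Let f : X → ℝ be locally Lipschitz continuous, let a ∈ X with a ≠ 0, let 0 < δ < δ', let s > 0 and set y := x − s·a/‖a‖ for some x ∈ X. Assume f(y) − f(x) > −δ·‖a‖·s. Then the set Λ := {λ ∈ [0,1] : there exists b ∈ ∂f(λx + (1−λ)y) with ⟨a,b⟩ ≤ δ'·‖a‖²} contains a Borel subset of [0,1] of positive Lebesgue measure; in particular Λ has positive Lebesgue outer measure. -/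
open Filter Metric Set Topology MeasureTheory
open scoped RealInnerProductSpace NNReal

variable {X : Type*} [NormedAddCommGroup X] [InnerProductSpace ℝ X] [CompleteSpace X]

section ClarkeCalculus

variable {E : Type*} [NormedAddCommGroup E] [InnerProductSpace ℝ E]

/-- Near a point of Lipschitz continuity the difference quotients in direction `h` are bounded
by a multiple of `‖h‖`. -/
lemma LocallyLipschitz.exists_eventually_abs_quotient_le {f : E → ℝ} (hf : LocallyLipschitz f)
    (z : E) : ∃ K : ℝ, 0 ≤ K ∧ ∀ h : E, ∀ᶠ p : E × ℝ in (𝓝 z) ×ˢ (𝓝[>] (0:ℝ)),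
      |(f (p.1 + p.2 • h) - f p.1) / p.2| ≤ K * ‖h‖ := by
  obtain ⟨K, t, ht, hK⟩ := hf z
  refine ⟨K, K.2, fun h => ?_⟩
  have h1 : ∀ᶠ p : E × ℝ in (𝓝 z) ×ˢ (𝓝[>] (0:ℝ)), p.1 ∈ t := tendsto_fst.eventually ht
  have h2 : ∀ᶠ p : E × ℝ in (𝓝 z) ×ˢ (𝓝[>] (0:ℝ)), 0 < p.2 :=
    tendsto_snd.eventually self_mem_nhdsWithin
  have h3 : Tendsto (fun p : E × ℝ => p.1 + p.2 • h) ((𝓝 z) ×ˢ (𝓝[>] (0:ℝ))) (𝓝 z) := by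
    have : Tendsto (fun p : E × ℝ => p.1 + p.2 • h) ((𝓝 z) ×ˢ (𝓝[>] (0:ℝ)))
        (𝓝 (z + (0:ℝ) • h)) :=
      tendsto_fst.add ((tendsto_snd.mono_right nhdsWithin_le_nhds).smul_const h)
    simpa using this
  filter_upwards [h1, h2, h3.eventually ht] with p hp1 hp2 hp3
  rw [abs_div, abs_of_pos hp2, div_le_iff₀ hp2]
  have := hK.dist_le_mul _ hp3 _ hp1
  rw [Real.dist_eq, dist_eq_norm, add_sub_cancel_left, norm_smul, Real.norm_eq_abs,
    abs_of_pos hp2] at this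
  linarith

lemma LocallyLipschitz.eventually_quotient_lt {f : E → ℝ} (hf : LocallyLipschitz f) {z h : E}
    {c : ℝ} (hc : clarkeDeriv f z h < c) :
    ∀ᶠ p : E × ℝ in (𝓝 z) ×ˢ (𝓝[>] (0:ℝ)), (f (p.1 + p.2 • h) - f p.1) / p.2 < c := by
  obtain ⟨K, -, hK⟩ := hf.exists_eventually_abs_quotient_le z
  exact eventually_lt_of_limsup_lt hc
    (isBoundedUnder_of_eventually_le ((hK h).mono fun p hp => (abs_le.1 hp).2))

lemma LocallyLipschitz.clarkeDeriv_le_of_eventually_le {f : E → ℝ} (hf : LocallyLipschitz f)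
    {z h : E} {c : ℝ}
    (hc : ∀ᶠ p : E × ℝ in (𝓝 z) ×ˢ (𝓝[>] (0:ℝ)), (f (p.1 + p.2 • h) - f p.1) / p.2 ≤ c) :
    clarkeDeriv f z h ≤ c := by
  obtain ⟨K, -, hK⟩ := hf.exists_eventually_abs_quotient_le z
  have hb : IsBoundedUnder (· ≥ ·) ((𝓝 z) ×ˢ (𝓝[>] (0:ℝ)))
      (fun p : E × ℝ => (f (p.1 + p.2 • h) - f p.1) / p.2) :=
    isBoundedUnder_of_eventually_ge ((hK h).mono fun p hp => (abs_le.1 hp).1)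
  exact limsup_le_of_le hb.isCoboundedUnder_le hc

lemma LocallyLipschitz.exists_clarkeDeriv_le {f : E → ℝ} (hf : LocallyLipschitz f) (z : E) :
    ∃ K : ℝ, 0 ≤ K ∧ ∀ h : E, clarkeDeriv f z h ≤ K * ‖h‖ := by
  obtain ⟨K, hK0, hK⟩ := hf.exists_eventually_abs_quotient_le z
  exact ⟨K, hK0, fun h => hf.clarkeDeriv_le_of_eventually_le
    ((hK h).mono fun p hp => (abs_le.1 hp).2)⟩

lemma LocallyLipschitz.clarkeDeriv_add_le {f : E → ℝ} (hf : LocallyLipschitz f) (z h k : E) :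
    clarkeDeriv f z (h + k) ≤ clarkeDeriv f z h + clarkeDeriv f z k := by
  refine le_of_forall_pos_le_add fun ε hε => hf.clarkeDeriv_le_of_eventually_le ?_
  have h1 := hf.eventually_quotient_lt (lt_add_of_pos_right (clarkeDeriv f z h) (half_pos hε))
  have h2 := hf.eventually_quotient_lt (lt_add_of_pos_right (clarkeDeriv f z k) (half_pos hε))
  have h3 : Tendsto (fun p : E × ℝ => (p.1 + p.2 • k, p.2)) ((𝓝 z) ×ˢ (𝓝[>] (0:ℝ)))
      ((𝓝 z) ×ˢ (𝓝[>] (0:ℝ))) := by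
    have : Tendsto (fun p : E × ℝ => p.1 + p.2 • k) ((𝓝 z) ×ˢ (𝓝[>] (0:ℝ)))
        (𝓝 (z + (0:ℝ) • k)) :=
      tendsto_fst.add ((tendsto_snd.mono_right nhdsWithin_le_nhds).smul_const k)
    rw [zero_smul, add_zero] at this
    exact this.prodMk tendsto_snd
  filter_upwards [h3.eventually h1, h2] with p hp1 hp2
  have e : p.1 + p.2 • (h + k) = p.1 + p.2 • k + p.2 • h := by rw [smul_add]; abel
  have e2 : (f (p.1 + p.2 • (h + k)) - f p.1) / p.2
      = (f (p.1 + p.2 • k + p.2 • h) - f (p.1 + p.2 • k)) / p.2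
        + (f (p.1 + p.2 • k) - f p.1) / p.2 := by
    rw [e, ← add_div]; ring
  rw [e2]
  linarith

lemma LocallyLipschitz.clarkeDeriv_smul_le {f : E → ℝ} (hf : LocallyLipschitz f) (z h : E)
    {c : ℝ} (hc : 0 < c) : clarkeDeriv f z (c • h) ≤ c * clarkeDeriv f z h := by
  refine le_of_forall_pos_le_add fun ε hε => hf.clarkeDeriv_le_of_eventually_le ?_
  have h1 := hf.eventually_quotient_lt (lt_add_of_pos_right (clarkeDeriv f z h) (div_pos hε hc))
  have h2 : ∀ᶠ p : E × ℝ in (𝓝 z) ×ˢ (𝓝[>] (0:ℝ)), 0 < p.2 :=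
    tendsto_snd.eventually self_mem_nhdsWithin
  have h3 : Tendsto (fun p : E × ℝ => (p.1, p.2 * c)) ((𝓝 z) ×ˢ (𝓝[>] (0:ℝ)))
      ((𝓝 z) ×ˢ (𝓝[>] (0:ℝ))) := by
    refine tendsto_fst.prodMk (tendsto_nhdsWithin_iff.2 ⟨?_, h2.mono fun p hp => mul_pos hp hc⟩)
    have : Tendsto (fun p : E × ℝ => p.2 * c) ((𝓝 z) ×ˢ (𝓝[>] (0:ℝ))) (𝓝 (0 * c)) :=
      (tendsto_snd.mono_right nhdsWithin_le_nhds).mul_const c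
    simpa using this
  filter_upwards [h3.eventually h1, h2] with p hp1 hp2
  have e : (f (p.1 + p.2 • c • h) - f p.1) / p.2
      = c * ((f (p.1 + (p.2 * c) • h) - f p.1) / (p.2 * c)) := by
    rw [smul_smul]; field_simp
  have e2 : c * (clarkeDeriv f z h + ε / c) = c * clarkeDeriv f z h + ε := by field_simp
  rw [e, ← e2]
  exact mul_le_mul_of_nonneg_left hp1.le hc.le

lemma LocallyLipschitz.clarkeDeriv_smul {f : E → ℝ} (hf : LocallyLipschitz f) (z h : E)
    {c : ℝ} (hc : 0 < c) : clarkeDeriv f z (c • h) = c * clarkeDeriv f z h := by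
  refine le_antisymm (hf.clarkeDeriv_smul_le z h hc) ?_
  have := hf.clarkeDeriv_smul_le z (c • h) (inv_pos.2 hc)
  rw [inv_smul_smul₀ hc.ne'] at this
  calc c * clarkeDeriv f z h ≤ c * (c⁻¹ * clarkeDeriv f z (c • h)) :=
        mul_le_mul_of_nonneg_left this hc.le
    _ = _ := by field_simp

/-- A directional derivative is bounded by Clarke's generalized one. -/
lemma LocallyLipschitz.le_clarkeDeriv_of_hasDerivAt {f : E → ℝ} (hf : LocallyLipschitz f)
    {z h : E} {d : ℝ} (hd : HasDerivAt (fun t : ℝ => f (z + t • h)) d 0) :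
    d ≤ clarkeDeriv f z h := by
  refine le_of_forall_gt_imp_ge_of_dense fun c hc => ?_
  have h1 := hf.eventually_quotient_lt hc
  have h2 : Tendsto (fun t : ℝ => (z, t)) (𝓝[>] (0:ℝ)) ((𝓝 z) ×ˢ (𝓝[>] (0:ℝ))) :=
    tendsto_const_nhds.prodMk tendsto_id
  refine le_of_tendsto hd.tendsto_slope_zero_right ((h2.eventually h1).mono fun t ht => ?_)
  rw [div_eq_inv_mul] at ht
  simpa using ht.le

end ClarkeCalculus

/-- The supremum of `⟪b, v⟫` over the generalized gradient is attained and equals the generalized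
directional derivative. -/
lemma LocallyLipschitz.exists_mem_clarkeGrad_inner_eq {f : X → ℝ} (hf : LocallyLipschitz f)
    (z : X) {v : X} (hv : v ≠ 0) : ∃ b ∈ clarkeGrad f z, ⟪b, v⟫ = clarkeDeriv f z v := by
  have h0 : clarkeDeriv f z 0 = 0 := by
    have := hf.clarkeDeriv_smul z 0 (two_pos)
    rw [smul_zero] at this
    linarith
  obtain ⟨φ, hφ, hφle⟩ := exists_extension_of_le_sublinear
    (LinearPMap.mkSpanSingleton (K := ℝ) (L := ℝ) (σ := RingHom.id ℝ) v (clarkeDeriv f z v) hv)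
    (clarkeDeriv f z)
    (fun c hc x => hf.clarkeDeriv_smul z x hc) (hf.clarkeDeriv_add_le z) (by
      rintro ⟨w, hw⟩
      obtain ⟨c, rfl⟩ := Submodule.mem_span_singleton.1 hw
      rw [LinearPMap.mkSpanSingleton'_apply]
      simp only [RingHom.id_apply, smul_eq_mul]
      rcases lt_trichotomy c 0 with hc | rfl | hc
      · have h1 := hf.clarkeDeriv_smul z v (neg_pos.2 hc)
        have h2 := hf.clarkeDeriv_add_le z (c • v) ((-c) • v)
        rw [← add_smul, add_neg_cancel, zero_smul, h0] at h2
        linarith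
      · simp [h0]
      · exact (hf.clarkeDeriv_smul z v hc).ge)
  obtain ⟨K, -, hK⟩ := hf.exists_clarkeDeriv_le z
  let ψ : X →L[ℝ] ℝ := φ.mkContinuous K fun w => by
    refine abs_le.2 ⟨?_, (hφle w).trans (hK w)⟩
    have := (hφle (-w)).trans (hK (-w))
    rw [map_neg, norm_neg] at this
    linarith
  refine ⟨(InnerProductSpace.toDual ℝ X).symm ψ, fun h => ?_, ?_⟩
  · rw [InnerProductSpace.toDual_symm_apply]
    exact hφle h
  · rw [InnerProductSpace.toDual_symm_apply]
    have := hφ ⟨v, Submodule.mem_span_singleton_self v⟩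
    rw [LinearPMap.mkSpanSingleton_apply] at this
    exact this

/-- A Lipschitz function whose mean slope on `[0,1]` is less than `c` has slope less than `c`
on a set of positive measure. -/
lemma LipschitzOnWith.volume_deriv_lt_pos {g : ℝ → ℝ} {K : ℝ≥0}
    (hg : LipschitzOnWith K g (Icc 0 1)) {c : ℝ} (hc : g 1 - g 0 < c) :
    0 < volume {l : ℝ | l ∈ Icc (0:ℝ) 1 ∧ DifferentiableAt ℝ g l ∧ deriv g l < c} := by
  have hac : AbsolutelyContinuousOnInterval g 0 1 :=
    LipschitzOnWith.absolutelyContinuousOnInterval (K := K) (by simpa using hg)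
  by_contra hB
  rw [not_lt, nonpos_iff_eq_zero] at hB
  have hle : ∀ᵐ l : ℝ, l ∈ Icc (0:ℝ) 1 → c ≤ deriv g l := by
    filter_upwards [hac.ae_differentiableAt, measure_eq_zero_iff_ae_notMem.1 hB] with l hl hl' hm
    by_contra hlt
    exact hl' ⟨hm, hl (by simpa using hm), not_le.1 hlt⟩
  have hint : ∫ _ in (0:ℝ)..1, c ≤ ∫ l in (0:ℝ)..1, deriv g l :=
    intervalIntegral.integral_mono_ae_restrict zero_le_one intervalIntegrable_const
      hac.intervalIntegrable_deriv ((ae_restrict_iff' measurableSet_Icc).2 hle)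
  rw [hac.integral_deriv_eq_sub] at hint
  simp at hint
  linarith

/-- Proposition 3.5(2): the set of parameters `λ ∈ [0,1]` admitting a generalized gradient
`b` with `⟪a,b⟫ ≤ δ'‖a‖²` contains a Borel set of positive Lebesgue measure. -/
theorem lambda_set_pos_measure
    (f : X → ℝ) (hf : LocallyLipschitz f)
    (a : X) (ha : a ≠ 0) (δ δ' : ℝ) (hδ : 0 < δ) (hδδ' : δ < δ')
    (s : ℝ) (hs : 0 < s) (x y : X) (hy : y = x - (s / ‖a‖) • a)
    (hviol : f y - f x > -δ * ‖a‖ * s) :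
    ∃ B : Set ℝ, MeasurableSet B ∧
      B ⊆ {l : ℝ | l ∈ Set.Icc (0:ℝ) 1 ∧
        ∃ b ∈ clarkeGrad f (l • x + (1 - l) • y), ⟪a, b⟫ ≤ δ' * ‖a‖ ^ 2} ∧
      0 < volume B := by
  set g : ℝ → ℝ := fun l => f (l • x + (1 - l) • y) with hg
  have ha' : 0 < ‖a‖ := norm_pos_iff.2 ha
  obtain ⟨K, hK⟩ : ∃ K, LipschitzOnWith K g (Icc 0 1) := by
    have hline : ContDiff ℝ 1 fun l : ℝ => l • x + (1 - l) • y := by fun_prop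
    exact (hf.comp hline.locallyLipschitz).locallyLipschitzOn.exists_lipschitzOnWith_of_compact
      isCompact_Icc
  refine ⟨{l | l ∈ Icc (0:ℝ) 1 ∧ DifferentiableAt ℝ g l ∧ deriv g l < δ' * ‖a‖ * s},
    measurableSet_Icc.inter ((measurableSet_of_differentiableAt ℝ g).inter
      (measurableSet_lt (measurable_deriv g) measurable_const)), ?_,
    hK.volume_deriv_lt_pos ?_⟩
  · rintro l ⟨hl, hdiff, hlt⟩
    refine ⟨hl, ?_⟩
    set z := l • x + (1 - l) • y with hz
    have hv : -((s / ‖a‖) • a) ≠ 0 := neg_ne_zero.2 (smul_ne_zero (div_pos hs ha').ne' ha)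
    obtain ⟨b, hb, hbv⟩ := hf.exists_mem_clarkeGrad_inner_eq z hv
    refine ⟨b, hb, ?_⟩
    have hd : HasDerivAt (fun t : ℝ => f (z + t • -((s / ‖a‖) • a))) (-deriv g l) 0 := by
      have h1 : HasDerivAt g (deriv g l) (l - 0) := by simpa using hdiff.hasDerivAt
      refine (h1.comp_const_sub l 0).congr_of_eventuallyEq (Eventually.of_forall fun t => ?_)
      simp only [hg, hz, hy]
      congr 1
      module
    have hle := hf.le_clarkeDeriv_of_hasDerivAt hd
    rw [← hbv, inner_neg_right, inner_smul_right, real_inner_comm, neg_le_neg_iff] at hle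
    have h2 : s / ‖a‖ * ⟪a, b⟫ < δ' * ‖a‖ * s := hle.trans_lt hlt
    have h3 : δ' * ‖a‖ * s = s / ‖a‖ * (δ' * ‖a‖ ^ 2) := by field_simp
    rw [h3] at h2
    exact (lt_of_mul_lt_mul_left h2 (div_pos hs ha').le).le
  · have h1 : δ * ‖a‖ * s < δ' * ‖a‖ * s := by gcongr
    simp only [hg, one_smul, sub_self, zero_smul, add_zero, sub_zero, zero_add]
    linarith
end

section
/- Let f : X → ℝ be locally Lipschitz continuous and let x ∈ X with 0 ∉ ∂f(x). Let T₁, T₂ : ℝ_{>0} → ℝ_{>0} be nondecreasing functions with lim_{t→0} T₁(t) = 0 and lim_{n→∞} T₂ⁿ(t) = 0 for every t > 0 (where T₂ⁿ denotes the n-fold composition of T₂ with itself). Let ε₀ > 0 be arbitrary and define ε_{i+1} := T₂(ε_i) for i ∈ ℕ. Then the set {i ∈ ℕ : there exists a ∈ ∂^{ε_i} f(x) with ‖a‖ < T₁(ε_i)} is finite. -/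
open Filter Metric Set Topology MeasureTheory
open scoped RealInnerProductSpace NNReal

variable {X : Type*} [NormedAddCommGroup X] [InnerProductSpace ℝ X] [CompleteSpace X]

/-- The difference quotients of a locally Lipschitz function are locally bounded. -/
theorem LocallyLipschitz.eventually_abs_quotient_le {f : X → ℝ} (hf : LocallyLipschitz f)
    (x h : X) :
    ∃ C : ℝ, ∀ᶠ p : X × ℝ in (𝓝 x) ×ˢ (𝓝[>] (0:ℝ)),
      |(f (p.1 + p.2 • h) - f p.1) / p.2| ≤ C := by
  obtain ⟨K, t, ht, hK⟩ := hf x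
  refine ⟨K * ‖h‖, ?_⟩
  have h_fst : Tendsto (fun p : X × ℝ => p.1) ((𝓝 x) ×ˢ (𝓝[>] (0:ℝ))) (𝓝 x) := tendsto_fst
  have h_snd : Tendsto (fun p : X × ℝ => p.2) ((𝓝 x) ×ˢ (𝓝[>] (0:ℝ))) (𝓝[>] 0) := tendsto_snd
  have h_add : Tendsto (fun p : X × ℝ => p.1 + p.2 • h) ((𝓝 x) ×ˢ (𝓝[>] (0:ℝ))) (𝓝 x) := by
    simpa using h_fst.add ((h_snd.mono_right nhdsWithin_le_nhds).smul_const h)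
  filter_upwards [h_fst ht, h_add ht, h_snd self_mem_nhdsWithin] with p h₁ h₂ h₃
  have hpos : 0 < p.2 := h₃
  have := hK.dist_le_mul _ h₂ _ h₁
  rw [Real.dist_eq, dist_eq_norm, add_sub_cancel_left, norm_smul, Real.norm_eq_abs,
    abs_of_pos hpos] at this
  rw [abs_div, abs_of_pos hpos, div_le_iff₀ hpos]
  linarith

/-- Clarke's directional derivative of a locally Lipschitz function is upper semicontinuous
in the base point. -/
theorem LocallyLipschitz.eventually_clarkeDeriv_le {f : X → ℝ} (hf : LocallyLipschitz f)
    {x h : X} {c : ℝ} (hc : clarkeDeriv f x h < c) :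
    ∀ᶠ y in 𝓝 x, clarkeDeriv f y h ≤ c := by
  obtain ⟨C, hC⟩ := hf.eventually_abs_quotient_le x h
  have hlt := eventually_lt_of_limsup_lt hc
    (isBoundedUnder_of_eventually_le (hC.mono fun _ hp => (abs_le.1 hp).2))
  obtain ⟨pa, ha, pb, hb, hab⟩ := eventually_prod_iff.1 hlt
  filter_upwards [eventually_eventually_nhds.2 ha] with y hy
  obtain ⟨D, hD⟩ := hf.eventually_abs_quotient_le y h
  refine limsup_le_of_le ?_ ?_
  · exact (isBoundedUnder_of_eventually_ge
      (hD.mono fun _ hp => (abs_le.1 hp).1)).isCoboundedUnder_le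
  · exact eventually_prod_iff.2 ⟨pa, hy, pb, hb, fun h₁ _ h₂ => (hab h₁ h₂).le⟩

/-- If all Clarke directional derivatives in direction `h` on a ball are at most `c`, then the
gradient on that ball lies in the half space `⟪·, h⟫ ≤ c`. -/
theorem inner_le_of_mem_epsGrad {f : X → ℝ} {x h a : X} {ε c : ℝ}
    (hc : ∀ y ∈ closedBall x ε, clarkeDeriv f y h ≤ c) (ha : a ∈ epsGrad f ε x) :
    ⟪a, h⟫ ≤ c := by
  have hconv : Convex ℝ {b : X | ⟪b, h⟫ ≤ c} :=
    convex_halfSpace_le ⟨fun u v => inner_add_left u v h,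
      fun r u => by rw [real_inner_smul_left, smul_eq_mul]⟩ c
  have hclosed : IsClosed {b : X | ⟪b, h⟫ ≤ c} :=
    isClosed_le (by fun_prop) continuous_const
  refine closure_minimal (convexHull_min ?_ hconv) hclosed ha
  exact iUnion₂_subset fun y hy b hb => (hb h).trans (hc y hy)

/-- If `0` is not a Clarke gradient at `x`, the gradients on small balls about `x` are uniformly
bounded away from `0`. -/
theorem LocallyLipschitz.exists_le_norm_of_mem_epsGrad {f : X → ℝ} (hf : LocallyLipschitz f)
    {x : X} (hx : (0 : X) ∉ clarkeGrad f x) :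
    ∃ δ > 0, ∃ r > 0, ∀ ε < δ, ∀ a ∈ epsGrad f ε x, r ≤ ‖a‖ := by
  simp only [clarkeGrad, mem_ofPred_eq, inner_zero_left, not_forall, not_le] at hx
  obtain ⟨h, hneg⟩ := hx
  obtain ⟨c, hc, hc0⟩ := exists_between hneg
  obtain ⟨δ, hδ, hball⟩ := Metric.eventually_nhds_iff_ball.1 (hf.eventually_clarkeDeriv_le hc)
  refine ⟨δ, hδ, -c / (‖h‖ + 1), div_pos (neg_pos.2 hc0) (by positivity), fun ε hε a ha => ?_⟩
  have hle := inner_le_of_mem_epsGrad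
    (fun y hy => hball y (closedBall_subset_ball hε hy)) ha
  have hcs := (abs_le.1 (abs_real_inner_le_norm a h)).1
  rw [div_le_iff₀ (by positivity)]
  nlinarith [norm_nonneg a]

/-- Proposition 3.9(2): if `0 ∉ ∂f(x)`, only finitely many null steps can occur. -/
theorem finitely_many_null_steps
    (f : X → ℝ) (hf : LocallyLipschitz f) (x : X)
    (hx : (0 : X) ∉ clarkeGrad f x)
    (T₁ T₂ : ℝ → ℝ)
    (hT₁pos : ∀ t : ℝ, 0 < t → 0 < T₁ t) (hT₁mono : MonotoneOn T₁ (Set.Ioi 0))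
    (hT₁lim : Tendsto T₁ (𝓝[>] (0:ℝ)) (𝓝 0))
    (hT₂pos : ∀ t : ℝ, 0 < t → 0 < T₂ t) (hT₂mono : MonotoneOn T₂ (Set.Ioi 0))
    (hT₂lim : ∀ t : ℝ, 0 < t → Tendsto (fun n => T₂^[n] t) atTop (𝓝 0))
    (εs : ℕ → ℝ) (hε0 : 0 < εs 0) (hεsS : ∀ i, εs (i+1) = T₂ (εs i)) :
    {i : ℕ | ∃ a ∈ epsGrad f (εs i) x, ‖a‖ < T₁ (εs i)}.Finite := by
  obtain ⟨δ, hδ, r, hr, hnorm⟩ := hf.exists_le_norm_of_mem_epsGrad hx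
  have hεpos : ∀ i, 0 < εs i := fun i => by
    induction i with
    | zero => exact hε0
    | succ n ih => exact hεsS n ▸ hT₂pos _ ih
  have hiter : ∀ i, T₂^[i] (εs 0) = εs i := fun i => by
    induction i with
    | zero => rfl
    | succ n ih => rw [Function.iterate_succ_apply', ih, hεsS]
  have hlim : Tendsto εs atTop (𝓝 0) := by simpa only [hiter] using hT₂lim _ hε0
  have hlim' : Tendsto εs atTop (𝓝[>] 0) :=
    tendsto_nhdsWithin_iff.2 ⟨hlim, Eventually.of_forall hεpos⟩
  have hev : ∀ᶠ i in atTop, ¬ ∃ a ∈ epsGrad f (εs i) x, ‖a‖ < T₁ (εs i) := by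
    filter_upwards [hlim.eventually_lt_const hδ, (hT₁lim.comp hlim').eventually_lt_const hr]
      with i h₁ h₂
    rintro ⟨a, ha, hlt⟩
    exact absurd (hnorm _ h₁ a ha) (not_le.2 (hlt.trans h₂))
  rw [← Nat.cofinite_eq_atTop, eventually_cofinite] at hev
  simpa only [not_not] using hev
end
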